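/- arXiv:1008.2435 — 2 statements merged into one kernel-verified Lean document; each statement's English description precedes it below -/
import Mathlib

section
/- Let 𝔤_λ be an oscillator Lie algebra and ξ : 𝔤_λ → ⋀²𝔤_λ a 1-cocycle with respect to the adjoint action. Then for any i, j ∈ {1,…,n}: α₋₁,₀(e₋₁) = 0; c_{i,i}(e₋₁) = 0; a₀,ᵢ(eᵢ) = ǎ₀,ᵢ(ěᵢ); a₀,ᵢ(ěᵢ) = −ǎ₀,ᵢ(eᵢ); bᵢ,ⱼ(e₋₁) = λⱼ ǎ₀,ⱼ(ěᵢ) − λᵢ a₀,ⱼ(eᵢ); b̌ᵢ,ⱼ(e₋₁) = λⱼ a₀,ⱼ(eᵢ) − λᵢ ǎ₀,ⱼ(ěᵢ); cⱼ,ᵢ(e₋₁) = λᵢ a₀,ⱼ(ěᵢ) + λⱼ ǎ₀,ⱼ(eᵢ); and cᵢ,ⱼ(e₋₁) = −λᵢ ǎ₀,ⱼ(eᵢ) − λⱼ a₀,ⱼ(ěᵢ). -/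
open Module LinearMap

noncomputable section

/-- Index type for the basis of an oscillator Lie algebra:
`Sum.inl 0 ↦ e₋₁`, `Sum.inl 1 ↦ e₀`, `Sum.inr (Sum.inl i) ↦ eᵢ`,
`Sum.inr (Sum.inr i) ↦ ěᵢ`. -/
abbrev OscIdx (n : ℕ) := Fin 2 ⊕ (Fin n ⊕ Fin n)

/-- The oscillator Lie algebra `𝔤_λ`: a real Lie algebra `L` together with a basis
`{e₋₁, e₀, e₁, …, eₙ, ě₁, …, ěₙ}` whose nonzero brackets on basis vectors are
`[e₋₁, eⱼ] = λⱼ ěⱼ`, `[e₋₁, ěⱼ] = −λⱼ eⱼ`, `[eⱼ, ěⱼ] = e₀` (all other brackets of the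
basis vectors vanish or follow by antisymmetry; in particular `e₀` is central). -/
structure OscAlg (n : ℕ) (lam : Fin n → ℝ) (L : Type) [LieRing L] [LieAlgebra ℝ L] where
  basis : Basis (OscIdx n) ℝ L
  bracket_em_e : ∀ j, ⁅basis (Sum.inl 0), basis (Sum.inr (Sum.inl j))⁆
      = lam j • basis (Sum.inr (Sum.inr j))
  bracket_em_f : ∀ j, ⁅basis (Sum.inl 0), basis (Sum.inr (Sum.inr j))⁆
      = -lam j • basis (Sum.inr (Sum.inl j))
  bracket_e_f : ∀ i j, ⁅basis (Sum.inr (Sum.inl i)), basis (Sum.inr (Sum.inr j))⁆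
      = if i = j then basis (Sum.inl 1) else 0
  bracket_e_e : ∀ i j, ⁅basis (Sum.inr (Sum.inl i)), basis (Sum.inr (Sum.inl j))⁆ = 0
  bracket_f_f : ∀ i j, ⁅basis (Sum.inr (Sum.inr i)), basis (Sum.inr (Sum.inr j))⁆ = 0
  bracket_e0 : ∀ x : L, ⁅basis (Sum.inl 1), x⁆ = 0

/-- `0 < λ₁ ≤ … ≤ λₙ`: the standing assumption on the parameters of an oscillator
Lie algebra. -/
def OscParam {n : ℕ} (lam : Fin n → ℝ) : Prop := (∀ i, 0 < lam i) ∧ Monotone lam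

/-- Genericity: `0 < λ₁ < … < λₙ` and `λ_k ≠ λ_i + λ_j` for all `i < j < k`. -/
def IsGeneric {n : ℕ} (lam : Fin n → ℝ) : Prop :=
  (∀ i, 0 < lam i) ∧ StrictMono lam ∧
    ∀ i j k : Fin n, i < j → j < k → lam k ≠ lam i + lam j

namespace OscAlg

variable {n : ℕ} {lam : Fin n → ℝ} {L : Type} [LieRing L] [LieAlgebra ℝ L]

/-- `e₋₁`. -/
def em (B : OscAlg n lam L) : L := B.basis (Sum.inl 0)
/-- `e₀`. -/
def e0 (B : OscAlg n lam L) : L := B.basis (Sum.inl 1)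
/-- `eᵢ`. -/
def e (B : OscAlg n lam L) (i : Fin n) : L := B.basis (Sum.inr (Sum.inl i))
/-- `ěᵢ`. -/
def f (B : OscAlg n lam L) (i : Fin n) : L := B.basis (Sum.inr (Sum.inr i))
/-- `e₋₁*`, an element of the dual basis. -/
def em' (B : OscAlg n lam L) : Dual ℝ L := B.basis.coord (Sum.inl 0)
/-- `e₀*`. -/
def e0' (B : OscAlg n lam L) : Dual ℝ L := B.basis.coord (Sum.inl 1)
/-- `eᵢ*`. -/
def e' (B : OscAlg n lam L) (i : Fin n) : Dual ℝ L := B.basis.coord (Sum.inr (Sum.inl i))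
/-- `ěᵢ*`. -/
def f' (B : OscAlg n lam L) (i : Fin n) : Dual ℝ L := B.basis.coord (Sum.inr (Sum.inr i))

/-- The subspace `S` spanned by the `eᵢ, ěᵢ`. -/
def S (B : OscAlg n lam L) : Submodule ℝ L :=
  Submodule.span ℝ (Set.range B.e ∪ Set.range B.f)

/-- The `2`-form `ω` on `𝔤_λ`, viewed as a linear map `𝔤_λ → 𝔤_λ*`:
`ω(e₋₁,·) = ω(e₀,·) = 0`, `ω(eᵢ,eⱼ) = ω(ěᵢ,ěⱼ) = 0`, `ω(eᵢ,ěⱼ) = δᵢⱼ`. -/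
def om (B : OscAlg n lam L) : L →ₗ[ℝ] Dual ℝ L :=
  ∑ i : Fin n, ((B.e' i).smulRight (B.f' i) - (B.f' i).smulRight (B.e' i))

/-- The derivation `J_a` of `𝔤_λ` given by `J_a(e₋₁) = J_a(e₀) = 0`, `J_a(eᵢ) = aᵢ ěᵢ`,
`J_a(ěᵢ) = −aᵢ eᵢ`. -/
def Ja (B : OscAlg n lam L) (a : Fin n → ℝ) : L →ₗ[ℝ] L :=
  B.basis.constr ℝ (Sum.elim (fun _ => (0 : L))
    (Sum.elim (fun i => a i • B.f i) (fun i => -(a i) • B.e i)))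

end OscAlg

section Bivectors

variable {L : Type} [LieRing L] [LieAlgebra ℝ L]

/-- `x ∧ y`, viewed as the linear map `𝔤* → 𝔤`, `α ↦ α(x) y − α(y) x`; this corresponds
to the skew-symmetric bilinear form `(α,β) ↦ α(x)β(y) − α(y)β(x)` on `𝔤*`. -/
def wedge (x y : L) : Dual ℝ L →ₗ[ℝ] L :=
  (Module.Dual.eval ℝ L x).smulRight y - (Module.Dual.eval ℝ L y).smulRight x

/-- A bivector `r ∈ ⋀²𝔤`, identified with the linear map `r_# : 𝔤* → 𝔤` of the
corresponding skew-symmetric bilinear form on `𝔤*` (so `r(α,β) = β(r_#(α))`). -/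
def IsBivector (r : Dual ℝ L →ₗ[ℝ] L) : Prop := ∀ α β : Dual ℝ L, α (r β) = - β (r α)

/-- The coadjoint action `ad*_u α := α ∘ ad_u`. -/
def coad (u : L) : Dual ℝ L →ₗ[ℝ] Dual ℝ L := (LieAlgebra.ad ℝ L u).dualMap

/-- `J† r` for an endomorphism `J` of `𝔤`; in terms of bilinear forms,
`(J† r)(α,β) = r(α∘J, β) + r(α, β∘J)`. -/
def dag (J : L →ₗ[ℝ] L) (r : Dual ℝ L →ₗ[ℝ] L) : Dual ℝ L →ₗ[ℝ] L :=
  r ∘ₗ J.dualMap + J ∘ₗ r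

/-- The adjoint action `ad_u† r` of `u ∈ 𝔤` on bivectors:
`(ad_u† r)(α,β) = r(ad*_u α, β) + r(α, ad*_u β)`. -/
def adDag (u : L) (r : Dual ℝ L →ₗ[ℝ] L) : Dual ℝ L →ₗ[ℝ] L :=
  dag (LieAlgebra.ad ℝ L u) r

/-- The Schouten bracket `[r,r]` of a bivector with itself:
`[r,r](α,β,γ) = 2α([r_#β, r_#γ]) + 2β([r_#γ, r_#α]) + 2γ([r_#α, r_#β])`. -/
def schouten (r : Dual ℝ L →ₗ[ℝ] L) (α β γ : Dual ℝ L) : ℝ :=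
  2 * α ⁅r β, r γ⁆ + 2 * β ⁅r γ, r α⁆ + 2 * γ ⁅r α, r β⁆

/-- `r` is a solution of the classical Yang–Baxter equation: `[r,r] = 0`. -/
def IsCYBE (r : Dual ℝ L →ₗ[ℝ] L) : Prop := ∀ α β γ : Dual ℝ L, schouten r α β γ = 0

/-- `r` is a solution of the generalized classical Yang–Baxter equation:
`ad_u [r,r] = 0` for all `u`. -/
def IsGCYBE (r : Dual ℝ L →ₗ[ℝ] L) : Prop :=
  ∀ (u : L) (α β γ : Dual ℝ L),
    schouten r (coad u α) β γ + schouten r α (coad u β) γ + schouten r α β (coad u γ) = 0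

/-- A derivation of the Lie algebra `L`. -/
def IsDerivation (J : L →ₗ[ℝ] L) : Prop := ∀ x y : L, J ⁅x, y⁆ = ⁅J x, y⁆ + ⁅x, J y⁆

/-- The 1-cocycle condition for `ξ : 𝔤 → ⋀²𝔤` with respect to the adjoint action:
`ξ([u,v]) = ad_u† ξ(v) − ad_v† ξ(u)`. -/
def IsCocycle (ξ : L →ₗ[ℝ] (Dual ℝ L →ₗ[ℝ] L)) : Prop :=
  ∀ u v : L, ξ ⁅u, v⁆ = adDag u (ξ v) - adDag v (ξ u)

/-- The dual bracket `[α,β]*` associated to `ξ : 𝔤 → ⋀²𝔤`: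
`[α,β]*(u) = ξ(u)(α,β)`. -/
def dualBr (ξ : L →ₗ[ℝ] (Dual ℝ L →ₗ[ℝ] L)) (α β : Dual ℝ L) : Dual ℝ L :=
  (β : L →ₗ[ℝ] ℝ) ∘ₗ (ξ.flip α)

/-- `ξ : 𝔤 → ⋀²𝔤` is a Lie bialgebra structure: `ξ` takes values in bivectors, is a
1-cocycle, and the dual bracket satisfies the Jacobi identity. -/
def IsBialgebra (ξ : L →ₗ[ℝ] (Dual ℝ L →ₗ[ℝ] L)) : Prop :=
  (∀ (u : L) (α β : Dual ℝ L), α (ξ u β) = - β (ξ u α)) ∧ IsCocycle ξ ∧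
  ∀ α β γ : Dual ℝ L,
    dualBr ξ (dualBr ξ α β) γ + dualBr ξ (dualBr ξ β γ) α + dualBr ξ (dualBr ξ γ α) β = 0

end Bivectors

namespace OscAlg

variable {n : ℕ} {lam : Fin n → ℝ} {L : Type} [LieRing L] [LieAlgebra ℝ L]

/-- Membership in `⋀²S`: a bivector `r` with `r_#(e₋₁*) = r_#(e₀*) = 0` and
`Im r_# ⊆ S`. -/
def InW2S (B : OscAlg n lam L) (r : Dual ℝ L →ₗ[ℝ] L) : Prop :=
  IsBivector r ∧ r B.em' = 0 ∧ r B.e0' = 0 ∧ ∀ α : Dual ℝ L, r α ∈ B.S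

/-- `ω_{r₁,r₂}(α,β) = (1/2)(ω(r₁_#(α), r₂_#(β)) + ω(r₂_#(α), r₁_#(β)))`. -/
def omPair (B : OscAlg n lam L) (r₁ r₂ : Dual ℝ L →ₗ[ℝ] L) (α β : Dual ℝ L) : ℝ :=
  (1/2) * (B.om (r₁ α) (r₂ β) + B.om (r₂ α) (r₁ β))

end OscAlg

namespace OscAlg

variable {n : ℕ} {lam : Fin n → ℝ} {L : Type} [LieRing L] [LieAlgebra ℝ L]

lemma bracket_e_em (B : OscAlg n lam L) (j : Fin n) :
    ⁅B.basis (Sum.inr (Sum.inl j)), B.basis (Sum.inl 0)⁆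
      = -(lam j • B.basis (Sum.inr (Sum.inr j))) := by
  rw [← lie_skew, B.bracket_em_e]

lemma bracket_f_em (B : OscAlg n lam L) (j : Fin n) :
    ⁅B.basis (Sum.inr (Sum.inr j)), B.basis (Sum.inl 0)⁆
      = lam j • B.basis (Sum.inr (Sum.inl j)) := by
  rw [← lie_skew, B.bracket_em_f, neg_smul, neg_neg]

lemma bracket_f_e (B : OscAlg n lam L) (i j : Fin n) :
    ⁅B.basis (Sum.inr (Sum.inr i)), B.basis (Sum.inr (Sum.inl j))⁆
      = if i = j then -B.basis (Sum.inl 1) else 0 := by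
  rw [← lie_skew, B.bracket_e_f]
  split_ifs <;> simp_all

lemma bracket_e0_right (B : OscAlg n lam L) (x : L) : ⁅x, B.basis (Sum.inl 1)⁆ = 0 := by
  rw [← lie_skew, B.bracket_e0, neg_zero]

/-- Linear functionals on an oscillator algebra agree if they agree on
`e₋₁`, `e₀`, `eₖ` and `ěₖ`. -/
lemma dual_ext (B : OscAlg n lam L) {α β : Dual ℝ L}
    (hem : α (B.basis (Sum.inl 0)) = β (B.basis (Sum.inl 0)))
    (he0 : α (B.basis (Sum.inl 1)) = β (B.basis (Sum.inl 1)))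
    (he : ∀ k, α (B.basis (Sum.inr (Sum.inl k))) = β (B.basis (Sum.inr (Sum.inl k))))
    (hf : ∀ k, α (B.basis (Sum.inr (Sum.inr k))) = β (B.basis (Sum.inr (Sum.inr k)))) :
    α = β := by
  refine B.basis.ext ?_
  rintro (k | k | k)
  · fin_cases k
    exacts [hem, he0]
  · exact he k
  · exact hf k

lemma coad_em_e0' (B : OscAlg n lam L) : coad B.em B.e0' = 0 := by
  refine B.dual_ext ?_ ?_ (fun k => ?_) fun k => ?_ <;>
    simp only [coad, em, e0', dualMap_apply, LieAlgebra.ad_apply, lie_self,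
      bracket_em_e, bracket_em_f, bracket_e0_right] <;>
    simp_all

lemma coad_e_e0' (B : OscAlg n lam L) (i : Fin n) : coad (B.e i) B.e0' = B.f' i := by
  refine B.dual_ext ?_ ?_ (fun k => ?_) fun k => ?_ <;>
    simp only [coad, e, e0', f', dualMap_apply, LieAlgebra.ad_apply,
      bracket_e_em, bracket_e_e, bracket_e_f, bracket_e0_right] <;>
    (try split_ifs) <;> simp_all [eq_comm]

lemma coad_f_e0' (B : OscAlg n lam L) (i : Fin n) : coad (B.f i) B.e0' = -B.e' i := by
  refine B.dual_ext ?_ ?_ (fun k => ?_) fun k => ?_ <;>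
    simp only [coad, f, e0', e', dualMap_apply, LieAlgebra.ad_apply,
      bracket_f_em, bracket_f_e, bracket_f_f, bracket_e0_right] <;>
    (try split_ifs) <;> simp_all [eq_comm]

lemma coad_em_e' (B : OscAlg n lam L) (j : Fin n) : coad B.em (B.e' j) = -(lam j • B.f' j) := by
  refine B.dual_ext ?_ ?_ (fun k => ?_) fun k => ?_ <;>
    simp only [coad, em, e', f', dualMap_apply, LieAlgebra.ad_apply, lie_self,
      bracket_em_e, bracket_em_f, bracket_e0_right] <;>
    simp_all [Finsupp.single_apply, eq_comm]

lemma coad_em_f' (B : OscAlg n lam L) (j : Fin n) : coad B.em (B.f' j) = lam j • B.e' j := by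
  refine B.dual_ext ?_ ?_ (fun k => ?_) fun k => ?_ <;>
    simp only [coad, em, f', e', dualMap_apply, LieAlgebra.ad_apply, lie_self,
      bracket_em_e, bracket_em_f, bracket_e0_right] <;>
    simp_all [Finsupp.single_apply, eq_comm]

lemma coad_e_e' (B : OscAlg n lam L) (i j : Fin n) : coad (B.e i) (B.e' j) = 0 := by
  refine B.dual_ext ?_ ?_ (fun k => ?_) fun k => ?_ <;>
    simp only [coad, e, e', dualMap_apply, LieAlgebra.ad_apply,
      bracket_e_em, bracket_e_e, bracket_e_f, bracket_e0_right] <;>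
    (try split_ifs) <;> simp_all [eq_comm]

lemma coad_e_f' (B : OscAlg n lam L) (i j : Fin n) :
    coad (B.e i) (B.f' j) = if i = j then -(lam i • B.em') else 0 := by
  refine B.dual_ext ?_ ?_ (fun k => ?_) fun k => ?_ <;>
    simp only [coad, e, f', em', dualMap_apply, LieAlgebra.ad_apply,
      bracket_e_em, bracket_e_e, bracket_e_f, bracket_e0_right] <;>
    (try split_ifs) <;> simp_all [eq_comm]

lemma coad_f_e' (B : OscAlg n lam L) (i j : Fin n) :
    coad (B.f i) (B.e' j) = if i = j then lam i • B.em' else 0 := by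
  refine B.dual_ext ?_ ?_ (fun k => ?_) fun k => ?_ <;>
    simp only [coad, f, e', em', dualMap_apply, LieAlgebra.ad_apply,
      bracket_f_em, bracket_f_e, bracket_f_f, bracket_e0_right] <;>
    (try split_ifs) <;> simp_all [eq_comm]

lemma coad_f_f' (B : OscAlg n lam L) (i j : Fin n) : coad (B.f i) (B.f' j) = 0 := by
  refine B.dual_ext ?_ ?_ (fun k => ?_) fun k => ?_ <;>
    simp only [coad, f, f', dualMap_apply, LieAlgebra.ad_apply,
      bracket_f_em, bracket_f_e, bracket_f_f, bracket_e0_right] <;>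
    (try split_ifs) <;> simp_all [eq_comm]

end OscAlg

/-- The cocycle condition written in terms of skew-symmetric bilinear forms on the dual. -/
lemma IsCocycle.apply_eq {L : Type} [LieRing L] [LieAlgebra ℝ L]
    {ξ : L →ₗ[ℝ] (Dual ℝ L →ₗ[ℝ] L)} (hcoc : IsCocycle ξ) (u v : L) (α β : Dual ℝ L) :
    β (ξ ⁅u, v⁆ α) = β (ξ v (coad u α)) + coad u β (ξ v α)
      - (β (ξ u (coad v α)) + coad v β (ξ u α)) := by
  simp [hcoc u v, adDag, dag, coad]

/-- **Proposition.** For a 1-cocycle `ξ` on an oscillator Lie algebra and all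
`i, j ∈ {1,…,n}`: `α₋₁,₀(e₋₁) = 0`, `c_{i,i}(e₋₁) = 0`, `a₀,ᵢ(eᵢ) = ǎ₀,ᵢ(ěᵢ)`,
`a₀,ᵢ(ěᵢ) = −ǎ₀,ᵢ(eᵢ)`, `bᵢ,ⱼ(e₋₁) = λⱼ ǎ₀,ⱼ(ěᵢ) − λᵢ a₀,ⱼ(eᵢ)`,
`b̌ᵢ,ⱼ(e₋₁) = λⱼ a₀,ⱼ(eᵢ) − λᵢ ǎ₀,ⱼ(ěᵢ)`, `cⱼ,ᵢ(e₋₁) = λᵢ a₀,ⱼ(ěᵢ) + λⱼ ǎ₀,ⱼ(eᵢ)`,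
`cᵢ,ⱼ(e₋₁) = −λᵢ ǎ₀,ⱼ(eᵢ) − λⱼ a₀,ⱼ(ěᵢ)`. -/
theorem oscillator_cocycle_em_relations
    {n : ℕ} (hn : 0 < n) {lam : Fin n → ℝ} (hlam : OscParam lam)
    {L : Type} [LieRing L] [LieAlgebra ℝ L] (B : OscAlg n lam L)
    (ξ : L →ₗ[ℝ] (Dual ℝ L →ₗ[ℝ] L))
    (hskew : ∀ (u : L) (α β : Dual ℝ L), α (ξ u β) = - β (ξ u α))
    (hcoc : IsCocycle ξ)
    (i j : Fin n) :
    B.e0' (ξ B.em B.em') = 0 ∧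
    B.f' i (ξ B.em (B.e' i)) = 0 ∧
    B.e' i (ξ (B.e i) B.e0') = B.f' i (ξ (B.f i) B.e0') ∧
    B.e' i (ξ (B.f i) B.e0') = -(B.f' i (ξ (B.e i) B.e0')) ∧
    B.e' j (ξ B.em (B.e' i))
      = lam j * (B.f' j (ξ (B.f i) B.e0')) - lam i * (B.e' j (ξ (B.e i) B.e0')) ∧
    B.f' j (ξ B.em (B.f' i))
      = lam j * (B.e' j (ξ (B.e i) B.e0')) - lam i * (B.f' j (ξ (B.f i) B.e0')) ∧
    B.f' i (ξ B.em (B.e' j))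
      = lam i * (B.e' j (ξ (B.f i) B.e0')) + lam j * (B.f' j (ξ (B.e i) B.e0')) ∧
    B.f' j (ξ B.em (B.e' i))
      = -(lam i * (B.f' j (ξ (B.e i) B.e0'))) - lam j * (B.e' j (ξ (B.f i) B.e0')) := by
  have brE : ∀ i, ⁅B.em, B.e i⁆ = lam i • B.f i := B.bracket_em_e
  have brF : ∀ i, ⁅B.em, B.f i⁆ = -lam i • B.e i := B.bracket_em_f
  have eE : ∀ i j, lam i * B.e' j (ξ (B.f i) B.e0')
      = -(lam j * B.f' j (ξ (B.e i) B.e0')) + B.f' i (ξ B.em (B.e' j)) := fun i j => by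
    have h := hcoc.apply_eq B.em (B.e i) B.e0' (B.e' j)
    simp only [brE, B.coad_em_e0', B.coad_e_e0', B.coad_em_e', B.coad_e_e'] at h
    simp at h
    linarith [hskew B.em (B.e' j) (B.f' i)]
  have eF : ∀ i j, lam i * B.f' j (ξ (B.f i) B.e0')
      = lam j * B.e' j (ξ (B.e i) B.e0') - B.f' j (ξ B.em (B.f' i))
        - if i = j then lam i * B.e0' (ξ B.em B.em') else 0 := fun i j => by
    have h := hcoc.apply_eq B.em (B.e i) B.e0' (B.f' j)
    simp only [brE, B.coad_em_e0', B.coad_e_e0', B.coad_em_f', B.coad_e_f'] at h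
    have := hskew B.em B.em' B.e0'
    split_ifs at h ⊢ <;> simp [this] at h <;> linarith
  have fE : ∀ i j, -(lam i * B.e' j (ξ (B.e i) B.e0'))
      = -(lam j * B.f' j (ξ (B.f i) B.e0')) + B.e' j (ξ B.em (B.e' i))
        + if i = j then lam i * B.e0' (ξ B.em B.em') else 0 := fun i j => by
    have h := hcoc.apply_eq B.em (B.f i) B.e0' (B.e' j)
    simp only [brF, B.coad_em_e0', B.coad_f_e0', B.coad_em_e', B.coad_f_e'] at h
    have := hskew B.em B.em' B.e0'
    split_ifs at h ⊢ <;> simp [this] at h <;> linarith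
  have fF : ∀ i j, -(lam i * B.f' j (ξ (B.e i) B.e0'))
      = lam j * B.e' j (ξ (B.f i) B.e0') + B.f' j (ξ B.em (B.e' i)) := fun i j => by
    have h := hcoc.apply_eq B.em (B.f i) B.e0' (B.f' j)
    simp only [brF, B.coad_em_e0', B.coad_f_e0', B.coad_em_f', B.coad_f_f'] at h
    simp at h
    linarith
  have hpos := hlam.1 i
  have hα : B.e0' (ξ B.em B.em') = 0 := by
    have h₁ := eF i i
    have h₂ := fE i i
    rw [if_pos rfl] at h₁ h₂
    have h₃ := hskew B.em (B.f' i) (B.f' i)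
    have h₄ := hskew B.em (B.e' i) (B.e' i)
    have : lam i * B.e0' (ξ B.em B.em') = 0 := by linarith
    exact (mul_eq_zero.mp this).resolve_left hpos.ne'
  simp only [hα, mul_zero, ite_self] at eF fE
  refine ⟨hα, ?_, ?_, ?_, ?_, ?_, ?_, ?_⟩
  · linarith [eE i i, fF i i]
  · refine mul_left_cancel₀ hpos.ne' ?_
    linarith [eF i i, hskew B.em (B.f' i) (B.f' i)]
  · refine mul_left_cancel₀ hpos.ne' ?_
    linarith [eE i i, fF i i]
  · linarith [fE i j]
  · linarith [eF i j]
  · linarith [eE i j]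
  · linarith [fF i j]
end
end

section
/- Let 𝔤_λ be an oscillator Lie algebra and let ξ : 𝔤_λ → ⋀²𝔤_λ be a Lie bialgebra structure on 𝔤_λ. Then e₋₁* is a central element of the dual Lie algebra (𝔤_λ*, [·,·]*), i.e. [e₋₁*, α]* = 0 for all α ∈ 𝔤_λ*. -/
open Module LinearMap

noncomputable section

namespace OscAlg

variable {n : ℕ} {lam : Fin n → ℝ} {L : Type} [LieRing L] [LieAlgebra ℝ L]

/-- The basis vectors `eᵢ, ěᵢ` of `S`, indexed uniformly. -/
def sVec (B : OscAlg n lam L) (k : Fin n ⊕ Fin n) : L := B.basis (Sum.inr k)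

/-- The coordinates dual to `sVec`. -/
def sCoord (B : OscAlg n lam L) (k : Fin n ⊕ Fin n) : Dual ℝ L := B.basis.coord (Sum.inr k)

/-- The sign `+1` on the indices of the `eᵢ` and `-1` on the indices of the `ěᵢ`. -/
def sgn {n : ℕ} : Fin n ⊕ Fin n → ℝ := Sum.elim (fun _ => 1) (fun _ => -1)

/-- The frequency `λᵢ` attached to both `eᵢ` and `ěᵢ`. -/
def freq (lam : Fin n → ℝ) : Fin n ⊕ Fin n → ℝ := Sum.elim lam lam

lemma sgn_ne_zero (k : Fin n ⊕ Fin n) : sgn k ≠ 0 := by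
  rcases k with k | k <;> simp [sgn]

lemma sgn_swap (k : Fin n ⊕ Fin n) : sgn k.swap = -sgn k := by
  rcases k with k | k <;> simp [sgn]

lemma freq_swap (k : Fin n ⊕ Fin n) : freq lam k.swap = freq lam k := by
  rcases k with k | k <;> simp [freq]

lemma freq_pos (hlam : OscParam lam) (k : Fin n ⊕ Fin n) : 0 < freq lam k := by
  rcases k with k | k <;> simp [freq, hlam.1 k]

lemma swap_ne_self (k : Fin n ⊕ Fin n) : k.swap ≠ k := by
  rcases k with k | k <;> simp

/-- Two vectors with the same coordinates are equal. -/
lemma eq_of_coords (B : OscAlg n lam L) {x y : L} (hm : B.em' x = B.em' y)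
    (h0 : B.e0' x = B.e0' y) (hs : ∀ i, B.sCoord i x = B.sCoord i y) : x = y := by
  refine B.basis.ext_elem fun i => ?_
  rcases i with i | i
  · fin_cases i
    · exact hm
    · exact h0
  · exact hs i

/-- Two linear maps agreeing on the basis are equal. -/
lemma linearMap_ext (B : OscAlg n lam L) {M : Type*} [AddCommGroup M] [Module ℝ M]
    {φ ψ : L →ₗ[ℝ] M} (hm : φ B.em = ψ B.em) (h0 : φ B.e0 = ψ B.e0)
    (hs : ∀ i, φ (B.sVec i) = ψ (B.sVec i)) : φ = ψ := by
  refine B.basis.ext fun i => ?_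
  rcases i with i | i
  · fin_cases i
    · exact hm
    · exact h0
  · exact hs i

section Coordinates

variable (B : OscAlg n lam L)

@[simp] lemma em'_em : B.em' B.em = 1 := by simp [em', em]
@[simp] lemma em'_e0 : B.em' B.e0 = 0 := by simp [em', e0]
@[simp] lemma em'_sVec (k) : B.em' (B.sVec k) = 0 := by simp [em', sVec]
@[simp] lemma e0'_em : B.e0' B.em = 0 := by simp [e0', em]
@[simp] lemma e0'_e0 : B.e0' B.e0 = 1 := by simp [e0', e0]
@[simp] lemma e0'_sVec (k) : B.e0' (B.sVec k) = 0 := by simp [e0', sVec]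
@[simp] lemma sCoord_em (i) : B.sCoord i B.em = 0 := by simp [sCoord, em]
@[simp] lemma sCoord_e0 (i) : B.sCoord i B.e0 = 0 := by simp [sCoord, e0]
@[simp] lemma sCoord_sVec (i k) : B.sCoord i (B.sVec k) = if i = k then 1 else 0 := by
  simp [sCoord, sVec, Finsupp.single_apply, eq_comm]

lemma sum_coords (x : L) :
    x = B.em' x • B.em + B.e0' x • B.e0 + ∑ k, B.sCoord k x • B.sVec k := by
  conv_lhs => rw [← B.basis.sum_repr x]
  rw [Fintype.sum_sum_type, Fin.sum_univ_two]
  rfl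

end Coordinates

section Brackets

variable (B : OscAlg n lam L)

@[simp] lemma lie_e0_left (x : L) : ⁅B.e0, x⁆ = 0 := B.bracket_e0 x

@[simp] lemma lie_e0_right (x : L) : ⁅x, B.e0⁆ = 0 := by
  rw [← lie_skew, lie_e0_left, neg_zero]

lemma lie_em_sVec (k) : ⁅B.em, B.sVec k⁆ = (sgn k * freq lam k) • B.sVec k.swap := by
  rcases k with k | k
  · simpa [sgn, freq, em, sVec] using B.bracket_em_e k
  · simpa [sgn, freq, em, sVec] using B.bracket_em_f k

lemma lie_sVec_em (k) : ⁅B.sVec k, B.em⁆ = -(sgn k * freq lam k) • B.sVec k.swap := by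
  rw [← lie_skew, lie_em_sVec, neg_smul]

lemma lie_sVec_sVec (j k) :
    ⁅B.sVec j, B.sVec k⁆ = (if k = j.swap then sgn j else 0) • B.e0 := by
  rcases j with j | j <;> rcases k with k | k
  · simpa [sVec] using B.bracket_e_e j k
  · rw [sVec, sVec, B.bracket_e_f j k]
    by_cases hjk : j = k <;> simp [hjk, sgn, e0, eq_comm]
  · have h := B.bracket_e_f k j
    rw [← lie_skew]
    simp only [sVec]
    rw [h]
    by_cases hkj : k = j <;> simp [hkj, sgn, e0]
  · simpa [sVec] using B.bracket_f_f j k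

lemma coad_em' (u : L) : coad u B.em' = 0 := by
  have key : ∀ v w : L, B.em' ⁅v, w⁆ = 0 := by
    intro v w
    have h : (B.em' ∘ₗ (LieAlgebra.ad ℝ L v : L →ₗ[ℝ] L)) = 0 := by
      have hv : ∀ k, B.em' ⁅v, B.sVec k⁆ = 0 := by
        intro k
        rw [B.sum_coords v]
        simp [sum_lie, lie_em_sVec, lie_sVec_sVec]
      refine B.linearMap_ext ?_ (by simp) (by simpa using hv)
      · simp only [LinearMap.comp_apply, LieAlgebra.ad_apply, LinearMap.zero_apply]
        rw [B.sum_coords v]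
        simp [sum_lie, lie_sVec_em]
    exact LinearMap.congr_fun h w
  ext w
  exact key u w

lemma coad_em_e0'_s11 : coad B.em B.e0' = 0 :=
  B.linearMap_ext (by simp [coad]) (by simp [coad]) (by simp [coad, lie_em_sVec])

lemma coad_em_sCoord (i) :
    coad B.em (B.sCoord i) = -(sgn i * freq lam i) • B.sCoord i.swap := by
  refine B.linearMap_ext (by simp [coad]) (by simp [coad]) fun k => ?_
  by_cases h : i = k.swap
  · subst h
    simp [coad, lie_em_sVec, sgn_swap, freq_swap]
  · have h' : i.swap ≠ k := by rintro rfl; simp at h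
    simp [coad, lie_em_sVec, h, h']

lemma coad_sVec_e0' (j) : coad (B.sVec j) B.e0' = sgn j • B.sCoord j.swap := by
  refine B.linearMap_ext (by simp [coad, lie_sVec_em]) (by simp [coad]) fun k => ?_
  by_cases h : k = j.swap <;> simp [coad, lie_sVec_sVec, h, eq_comm]

lemma coad_sVec_sCoord (i j) :
    coad (B.sVec j) (B.sCoord i) =
      (if i = j.swap then -(sgn j * freq lam j) else 0) • B.em' := by
  refine B.linearMap_ext ?_ (by simp [coad, -ite_smul])
    (by simp [coad, lie_sVec_sVec, -ite_smul])
  by_cases h : i = j.swap <;> simp [coad, lie_sVec_em, h]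

end Brackets

end OscAlg

section Cocycles

variable {L : Type} [LieRing L] [LieAlgebra ℝ L] {ξ : L →ₗ[ℝ] (Dual ℝ L →ₗ[ℝ] L)}

/-- The cocycle condition evaluated on a pair of linear forms. -/
lemma IsCocycle.apply (h : IsCocycle ξ) (u v : L) (α β : Dual ℝ L) :
    β (ξ ⁅u, v⁆ α) = β (ξ v (coad u α)) + coad u β (ξ v α)
      - (β (ξ u (coad v α)) + coad v β (ξ u α)) := by
  rw [h u v]
  simp [adDag, dag, coad]

/-- The Jacobi identity of the dual bracket says that `β ↦ β ∘ (ξ · ζ)` is a derivation. -/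
lemma IsBialgebra.apply_apply (h : IsBialgebra ξ) (u : L) (ζ α β : Dual ℝ L) :
    β (ξ (ξ u ζ) α) = β (ξ u (dualBr ξ ζ α)) + dualBr ξ ζ β (ξ u α) := by
  have hj := LinearMap.congr_fun (h.2.2 ζ α β) u
  have hskew : dualBr ξ β ζ = -dualBr ξ ζ β := by
    ext v
    simpa [dualBr] using h.1 v ζ β
  have h1 := h.1 u ζ (dualBr ξ α β)
  have h2 := h.1 u α (dualBr ξ ζ β)
  simp only [hskew] at hj
  simp only [dualBr, LinearMap.add_apply, LinearMap.comp_apply, LinearMap.flip_apply,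
    LinearMap.zero_apply, LinearMap.neg_apply, map_neg] at hj h1 h2 ⊢
  linarith

end Cocycles

namespace OscAlg

variable {n : ℕ} {lam : Fin n → ℝ} {L : Type} [LieRing L] [LieAlgebra ℝ L]
  {ξ : L →ₗ[ℝ] (Dual ℝ L →ₗ[ℝ] L)} (B : OscAlg n lam L)

lemma apply_self_eq_zero (hskew : ∀ u, IsBivector (ξ u)) (u : L) (α : Dual ℝ L) :
    α (ξ u α) = 0 := by
  linarith [hskew u α α]

/-- A cocycle vanishes on `e₀`: there is no nonzero invariant bivector. -/
lemma cocycle_e0 (hn : 0 < n) (hlam : OscParam lam) (hskew : ∀ u, IsBivector (ξ u))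
    (hcoc : IsCocycle ξ) : ξ B.e0 = 0 := by
  have hinv : ∀ (v : L) (α β : Dual ℝ L),
      β (ξ B.e0 (coad v α)) + coad v β (ξ B.e0 α) = 0 := by
    intro v α β
    have h := hcoc.apply B.e0 v α β
    have hc : ∀ γ : Dual ℝ L, coad B.e0 γ = 0 := fun γ => by ext; simp [coad]
    simp only [hc, lie_e0_left, map_zero, LinearMap.zero_apply] at h
    linarith
  have hsm : ∀ i, B.em' (ξ B.e0 (B.sCoord i)) = 0 := by
    intro i
    have h := hinv (B.sVec i.swap) B.e0' B.em'
    simpa [coad_sVec_e0', coad_em', sgn_ne_zero] using h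
  have hss : ∀ i k, sgn k.swap * B.sCoord i (ξ B.e0 (B.sCoord k)) =
      (if i = k then sgn k.swap * freq lam k else 0) * B.em' (ξ B.e0 B.e0') := by
    intro i k
    have h := hinv (B.sVec k.swap) B.e0' (B.sCoord i)
    simp only [coad_sVec_e0', coad_sVec_sCoord, Sum.swap_swap, map_smul,
      LinearMap.smul_apply, smul_eq_mul, freq_swap] at h
    split_ifs at h ⊢ <;> linarith
  have h0m : B.em' (ξ B.e0 B.e0') = 0 := by
    have h := hss (Sum.inl ⟨0, hn⟩) (Sum.inl ⟨0, hn⟩)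
    rw [apply_self_eq_zero hskew] at h
    simpa [sgn_ne_zero, (freq_pos hlam _).ne'] using h
  have hss0 : ∀ i k, B.sCoord i (ξ B.e0 (B.sCoord k)) = 0 := by
    intro i k
    have h := hss i k
    simpa [h0m, sgn_ne_zero] using h
  have h0s : ∀ i, B.sCoord i (ξ B.e0 B.e0') = 0 := by
    intro i
    have h := hinv B.em B.e0' (B.sCoord i.swap)
    simpa [coad_em_e0'_s11, coad_em_sCoord, sgn_ne_zero, (freq_pos hlam _).ne'] using h
  have hs : ∀ i, ξ B.e0 (B.sCoord i) = 0 := fun i =>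
    B.eq_of_coords (by simp [hsm]) (by rw [hskew, h0s]; simp) (by simp [hss0])
  have h0 : ξ B.e0 B.e0' = 0 :=
    B.eq_of_coords (by simp [h0m]) (by simp [apply_self_eq_zero hskew]) (by simp [h0s])
  have hm : ξ B.e0 B.em' = 0 :=
    B.eq_of_coords (by simp [apply_self_eq_zero hskew]) (by rw [hskew, h0m]; simp)
      (fun i => by rw [hskew, hsm]; simp)
  refine LinearMap.ext fun α => B.eq_of_coords ?_ ?_ fun i => ?_ <;>
    rw [← neg_inj, ← hskew] <;> simp [hs, h0, hm]

/-- The `S`-block of the derivation `u ↦ ξ u e₋₁*` vanishes. -/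
lemma sCoord_cocycle_sVec_em' (hn : 0 < n) (hlam : OscParam lam)
    (hskew : ∀ u, IsBivector (ξ u)) (hcoc : IsCocycle ξ) (l k) :
    B.sCoord l (ξ (B.sVec k) B.em') = 0 := by
  have he0 := B.cocycle_e0 hn hlam hskew hcoc
  have hrel : ∀ i l j k,
      (if i = j.swap then sgn j * freq lam j else 0) * B.sCoord l (ξ (B.sVec k) B.em')
      - (if l = j.swap then sgn j * freq lam j else 0) * B.sCoord i (ξ (B.sVec k) B.em')
      = (if i = k.swap then sgn k * freq lam k else 0) * B.sCoord l (ξ (B.sVec j) B.em')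
      - (if l = k.swap then sgn k * freq lam k else 0) *
        B.sCoord i (ξ (B.sVec j) B.em') := by
    intro i l j k
    have h := hcoc.apply (B.sVec j) (B.sVec k) (B.sCoord i) (B.sCoord l)
    simp only [lie_sVec_sVec, map_smul, he0, smul_zero, LinearMap.zero_apply, map_zero,
      coad_sVec_sCoord, LinearMap.smul_apply, smul_eq_mul] at h
    rw [hskew _ B.em', hskew _ B.em'] at h
    split_ifs at h ⊢ <;> linarith
  have hcomm : ∀ l k, sgn k * freq lam k * B.sCoord l (ξ (B.sVec k.swap) B.em') =
      -(sgn l * freq lam l) * B.sCoord l.swap (ξ (B.sVec k) B.em') := by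
    intro l k
    have h := hcoc.apply B.em (B.sVec k) B.em' (B.sCoord l)
    simp only [lie_em_sVec, coad_em', coad_em_sCoord, coad_sVec_sCoord, map_smul,
      LinearMap.smul_apply, smul_eq_mul, map_zero, apply_self_eq_zero hskew] at h
    linarith
  have hsymp : B.sCoord k.swap (ξ (B.sVec k.swap) B.em') =
      -B.sCoord k (ξ (B.sVec k) B.em') := by
    have h := hcoc.apply (B.sVec k) (B.sVec k.swap) B.em' B.e0'
    simp only [lie_sVec_sVec, map_smul, he0, smul_zero, LinearMap.zero_apply, map_zero,
      coad_em', coad_sVec_e0', LinearMap.smul_apply, smul_eq_mul, sgn_swap,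
      Sum.swap_swap] at h
    exact mul_left_cancel₀ (sgn_ne_zero k) (by linarith)
  have hc : sgn k * freq lam k ≠ 0 := mul_ne_zero (sgn_ne_zero k) (freq_pos hlam k).ne'
  by_cases hlk : l = k
  · subst hlk
    have h := hcomm l.swap l
    simp only [sgn_swap, freq_swap, Sum.swap_swap, hsymp] at h
    refine mul_left_cancel₀ hc ?_
    linarith
  · have h := hrel k l k.swap k
    by_cases hl : l = k.swap
    · subst hl
      have h' := hcomm k k
      simp only [Sum.swap_swap, hlk, Ne.symm hlk, sgn_swap, freq_swap, if_true, if_false]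
        at h
      refine mul_left_cancel₀ hc ?_
      linarith
    · simpa [hlk, hl, (swap_ne_self k).symm, sgn_ne_zero, (freq_pos hlam _).ne'] using h

/-- The `e₀`-component of `ξ e₋₁ e₋₁*` vanishes. -/
lemma e0'_cocycle_em_em' (hn : 0 < n) (hlam : OscParam lam)
    (hskew : ∀ u, IsBivector (ξ u)) (hcoc : IsCocycle ξ) :
    B.e0' (ξ B.em B.em') = 0 := by
  have key : ∀ k, B.e0' (ξ (B.sVec k.swap) (B.sCoord k.swap)) =
      B.e0' (ξ (B.sVec k) (B.sCoord k)) + B.e0' (ξ B.em B.em') := by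
    intro k
    have h := hcoc.apply B.em (B.sVec k) (B.sCoord k.swap) B.e0'
    simp only [lie_em_sVec, coad_em_e0'_s11, coad_em_sCoord, coad_sVec_sCoord, coad_sVec_e0',
      map_smul, LinearMap.smul_apply, smul_eq_mul, LinearMap.zero_apply,
      apply_self_eq_zero hskew, sgn_swap, freq_swap, Sum.swap_swap, if_true] at h
    exact mul_left_cancel₀ (mul_ne_zero (sgn_ne_zero k) (freq_pos hlam k).ne')
      (by linarith)
  have h1 := key (Sum.inl ⟨0, hn⟩)
  have h2 := key (Sum.inr ⟨0, hn⟩)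
  simp only [Sum.swap_inl, Sum.swap_inr] at h1 h2
  linarith

/-- The `e₀`-components of `ξ s e₋₁*` are determined by the `S`-components of `ξ e₋₁ e₋₁*`. -/
lemma freq_mul_e0'_cocycle (hcoc : IsCocycle ξ) (i) :
    freq lam i * B.e0' (ξ (B.sVec i) B.em') = -B.sCoord i (ξ B.em B.em') := by
  have h := hcoc.apply B.em (B.sVec i.swap) B.em' B.e0'
  simp only [lie_em_sVec, coad_em', coad_em_e0'_s11, coad_sVec_e0', map_smul,
    LinearMap.smul_apply, smul_eq_mul, LinearMap.zero_apply, map_zero, freq_swap,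
    Sum.swap_swap] at h
  exact mul_left_cancel₀ (sgn_ne_zero i.swap) (by linarith)

/-- The `S`-components of `ξ e₋₁ e₋₁*` vanish. -/
lemma sCoord_bialgebra_em_em' (hn : 0 < n) (hlam : OscParam lam) (hbial : IsBialgebra ξ)
    (i) : B.sCoord i (ξ B.em B.em') = 0 := by
  have hskew : ∀ u, IsBivector (ξ u) := hbial.1
  have hcoc := hbial.2.1
  have he0 := B.cocycle_e0 hn hlam hskew hcoc
  have hS := B.sCoord_cocycle_sVec_em' hn hlam hskew hcoc
  set y := ξ B.em B.em' with hy
  have hym : B.em' y = 0 := apply_self_eq_zero hskew _ _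
  have hsA : ∀ j, dualBr ξ B.em' (B.sCoord j) = B.sCoord j y • B.em' := fun j =>
    B.linearMap_ext (by simp [dualBr, hy]) (by simp [dualBr, he0]) (by simp [dualBr, hS])
  have hAy : ξ y B.em' = B.e0' (ξ y B.em') • B.e0 := by
    refine B.eq_of_coords (by simp [apply_self_eq_zero hskew]) (by simp) fun j => ?_
    have h := LinearMap.congr_fun (hsA j) y
    simp [dualBr, hym] at h
    simp [h]
  have hyss : ∀ j, B.sCoord j (ξ y (B.sCoord i)) = 0 := by
    intro j
    have h := hbial.apply_apply B.em B.em' (B.sCoord i) (B.sCoord j)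
    simp only [hsA, map_smul, LinearMap.smul_apply, smul_eq_mul, ← hy] at h
    rw [hskew _ B.em', ← hy] at h
    linarith
  have hyi : ξ y (B.sCoord i) = B.e0' (ξ y (B.sCoord i)) • B.e0 := by
    refine B.eq_of_coords ?_ (by simp) (by simp [hyss])
    rw [hskew, hAy]
    simp
  have hprod : B.sCoord i y * B.e0' (ξ y B.em') = 0 := by
    have h := hbial.apply_apply y B.em' (B.sCoord i) B.e0'
    rw [hAy, hyi, hsA] at h
    simpa [he0, dualBr] using h.symm
  have hsum : B.e0' (ξ y B.em') = -∑ k, B.sCoord k y ^ 2 / freq lam k := by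
    have hk : ∀ k, B.e0' (ξ (B.sVec k) B.em') = -B.sCoord k y / freq lam k := by
      intro k
      rw [eq_div_iff (freq_pos hlam k).ne', mul_comm]
      exact B.freq_mul_e0'_cocycle hcoc k
    conv_lhs => rw [B.sum_coords y]
    simp only [hym, he0, map_add, map_smul, map_sum, LinearMap.smul_apply,
      LinearMap.sum_apply, hk, smul_eq_mul, ← Finset.sum_neg_distrib, zero_smul, smul_zero,
      zero_add]
    exact Finset.sum_congr rfl fun k _ => by ring
  rcases mul_eq_zero.mp hprod with h | h
  · exact h
  · rw [hsum, neg_eq_zero, Finset.sum_eq_zero_iff_of_nonneg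
      fun k _ => div_nonneg (sq_nonneg _) (freq_pos hlam k).le] at h
    simpa [(freq_pos hlam i).ne'] using h i (Finset.mem_univ i)

end OscAlg

/-- **Lemma.** For any Lie bialgebra structure `ξ` on an oscillator Lie algebra,
`e₋₁*` is a central element of the dual Lie algebra `(𝔤_λ*, [·,·]*)`. -/
theorem oscillator_bialgebra_em_dual_central
    {n : ℕ} (hn : 0 < n) {lam : Fin n → ℝ} (hlam : OscParam lam)
    {L : Type} [LieRing L] [LieAlgebra ℝ L] (B : OscAlg n lam L)
    (ξ : L →ₗ[ℝ] (Dual ℝ L →ₗ[ℝ] L))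
    (hbial : IsBialgebra ξ) :
    ∀ α : Dual ℝ L, dualBr ξ B.em' α = 0 := by
  have hskew : ∀ u, IsBivector (ξ u) := hbial.1
  have hcoc := hbial.2.1
  have hy := B.sCoord_bialgebra_em_em' hn hlam hbial
  have hA : ξ.flip B.em' = 0 := by
    refine B.linearMap_ext ?_ ?_ fun k => ?_
    · exact B.eq_of_coords (by simp [OscAlg.apply_self_eq_zero hskew])
        (by simp [B.e0'_cocycle_em_em' hn hlam hskew hcoc]) (by simp [hy])
    · simp [B.cocycle_e0 hn hlam hskew hcoc]
    · have h0 := B.freq_mul_e0'_cocycle hcoc k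
      rw [hy, neg_zero] at h0
      have h0' := (mul_eq_zero.mp h0).resolve_left (OscAlg.freq_pos hlam k).ne'
      exact B.eq_of_coords (by simp [OscAlg.apply_self_eq_zero hskew]) (by simp [h0'])
        (by simp [B.sCoord_cocycle_sVec_em' hn hlam hskew hcoc])
  intro α
  rw [dualBr, hA, LinearMap.comp_zero]
end
end
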